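/- Let X = ℝ/ℤ and T : X → X be a Lipschitz covering map of degree ≥ 2 in absolute value with fixed point c, expanding away from c (for every neighborhood V of c there is C > 1 with |T'| ≥ C a.e. off V). Let φ ∈ Lip(X) with φ(c) < β(φ). Then ψ(x) := sup_{n≥1} max_{y ∈ T^{-n} x} (S_n φ(y) - n β(φ)) defines a real-valued Lipschitz function on X satisfying φ ≤ ψ∘T - ψ + β(φ) on X (i.e., ψ is a Lipschitz sub-action of φ). -/

import Mathlib

open MeasureTheory Set

noncomputable def beta {X : Type*} [TopologicalSpace X] [MeasurableSpace X]
    (T : X → X) (φ : X → ℝ) : ℝ :=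
  sSup ((fun μ : Measure X => ∫ x, φ x ∂μ) ''
    {μ : Measure X | IsProbabilityMeasure μ ∧ μ.map T = μ})

/-- the candidate sub-action values at `x`:
`{S_n φ(y) - n β(φ) : n ≥ 1, T^n y = x}` -/
noncomputable def subActSet (T : UnitAddCircle → UnitAddCircle)
    (φ : UnitAddCircle → ℝ) (x : UnitAddCircle) : Set ℝ :=
  {r : ℝ | ∃ n : ℕ, 1 ≤ n ∧ ∃ y : UnitAddCircle, T^[n] y = x ∧
    r = ∑ k ∈ Finset.range n, φ (T^[k] y) - n * beta T φ}

/-- a monotone function whose derivative is at least `C` a.e. on `[u,v]` expands by `C` -/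
lemma aux_expand (F : ℝ → ℝ) (hFmono : Monotone F) (C u v : ℝ) (huv : u ≤ v)
    (h : ∀ᵐ x : ℝ, x ∈ Icc u v → C ≤ |deriv F x|) : C * (v - u) ≤ F v - F u := by
  have hm : MonotoneOn F (uIcc u v) := hFmono.monotoneOn _
  have hi := hm.intervalIntegrable_deriv
  have h1 := hm.intervalIntegral_deriv_mem_uIcc
  rw [uIcc_of_le (sub_nonneg.2 (hFmono huv))] at h1
  have h2 : ∫ x in u..v, C ≤ ∫ x in u..v, deriv F x := by
    apply intervalIntegral.integral_mono_ae_restrict huv (by simp) hi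
    rw [Filter.EventuallyLE, ae_restrict_iff' measurableSet_Icc]
    filter_upwards [h] with x hx hxm
    have := hx hxm
    rwa [abs_of_nonneg (hFmono.deriv_nonneg)] at this
  rw [intervalIntegral.integral_const, smul_eq_mul, mul_comm] at h2
  exact h2.trans h1.2

lemma aux_dist_le (a b : ℝ) : dist (a : UnitAddCircle) (b : UnitAddCircle) ≤ |a - b| := by
  rw [dist_eq_norm, ← QuotientAddGroup.mk_sub]
  have := QuotientAddGroup.norm_mk_le_norm (S := AddSubgroup.zmultiples (1:ℝ)) (m := a - b)
  exact this

lemma aux_expand_one (F : ℝ → ℝ) (hFmono : Monotone F) (c : UnitAddCircle)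
    (hexp : ∀ V : Set UnitAddCircle, IsOpen V → c ∈ V →
      ∃ C : ℝ, 1 < C ∧ ∀ᵐ x : ℝ, ((x : UnitAddCircle) ∉ V → C ≤ |deriv F x|))
    (a b : ℝ) (hab : a ≤ b) : b - a ≤ F b - F a := by
  have key : ∀ᵐ x : ℝ, 1 ≤ |deriv F x| := by
    have h1 : ∀ n : ℕ, ∀ᵐ x : ℝ, (x : UnitAddCircle) ∉ Metric.ball c (1 / ((n:ℝ) + 1)) →
        1 ≤ |deriv F x| := by
      intro n
      obtain ⟨C, hC, h⟩ := hexp (Metric.ball c (1 / ((n:ℝ) + 1))) Metric.isOpen_ball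
        (Metric.mem_ball_self (by positivity))
      filter_upwards [h] with x hx hx'
      exact hC.le.trans (hx hx')
    obtain ⟨c0, rfl⟩ := QuotientAddGroup.mk_surjective c
    have h2 : ∀ᵐ x : ℝ, x ∉ Set.range (fun m : ℤ => c0 + m) := by
      have : (Set.range (fun m : ℤ => c0 + (m:ℝ))).Countable := Set.countable_range _
      exact this.ae_notMem volume
    filter_upwards [ae_all_iff.2 h1, h2] with x hx hx2
    have hne : (x : UnitAddCircle) ≠ (c0 : UnitAddCircle) := by
      intro he
      obtain ⟨m, hm⟩ := AddCircle.coe_eq_zero_iff (p := (1:ℝ)) (x := x - c0) |>.1 (by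
        rw [AddCircle.coe_sub]; exact sub_eq_zero.2 he)
      refine hx2 ⟨m, ?_⟩
      simp at hm
      simp [hm]
    obtain ⟨n, hn⟩ := exists_nat_one_div_lt (dist_pos.2 hne)
    exact hx n (by rw [Metric.mem_ball, not_lt]; exact hn.le)
  have := aux_expand F hFmono 1 a b hab (key.mono fun x hx _ => hx)
  linarith

/-- weighted contraction of inverse branches -/
lemma aux_contract (F : ℝ → ℝ) (hFmono : Monotone F) (c : UnitAddCircle)
    (hexp : ∀ V : Set UnitAddCircle, IsOpen V → c ∈ V →
      ∃ C : ℝ, 1 < C ∧ ∀ᵐ x : ℝ, ((x : UnitAddCircle) ∉ V → C ≤ |deriv F x|))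
    (φ : UnitAddCircle → ℝ) (Kφ : NNReal) (hφ : LipschitzWith Kφ φ) (β : ℝ) (hgap : φ c < β) :
    ∃ s δ : ℝ, 0 < s ∧ 0 < δ ∧ ∀ a b : ℝ, |a - b| ≤ 1 →
      |a - b| ≤ Real.exp (-s * (φ a - β + δ)) * |F a - F b| := by
  have h1 := aux_expand_one F hFmono c hexp
  have h1' : ∀ a b, |a - b| ≤ |F a - F b| := by
    intro a b
    rcases le_total a b with h | h
    · rw [abs_sub_comm, abs_sub_comm (F a), abs_of_nonneg (by linarith)]
      exact (h1 a b h).trans (le_abs_self _)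
    · rw [abs_of_nonneg (by linarith)]
      exact (h1 b a h).trans (le_abs_self _)
  obtain ⟨δ, hδ⟩ : ∃ δ, δ = (β - φ c) / 2 := ⟨_, rfl⟩
  have hδ0 : 0 < δ := by rw [hδ]; linarith
  obtain ⟨r, hr⟩ : ∃ r, r = min 1 (δ / (2 * ((Kφ:ℝ) + 1))) := ⟨_, rfl⟩
  have hK : (0:ℝ) ≤ Kφ := Kφ.2
  have hr0 : 0 < r := by rw [hr]; positivity
  have hr1 : r ≤ 1 := by rw [hr]; exact min_le_left _ _
  have hr2 : r * (2 * ((Kφ:ℝ) + 1)) ≤ δ := by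
    rw [← le_div_iff₀ (by positivity), hr]; exact min_le_right _ _
  have hV : ∀ x, dist x c < 2 * r → φ x - β + δ ≤ 0 := by
    intro x hx
    have h3 := hφ.dist_le_mul x c
    rw [Real.dist_eq] at h3
    have h4 := le_abs_self (φ x - φ c)
    have h5 : (Kφ:ℝ) * dist x c ≤ Kφ * (2 * r) := by gcongr
    nlinarith
  obtain ⟨C, hC, hCe⟩ := hexp (Metric.ball c r) Metric.isOpen_ball (Metric.mem_ball_self hr0)
  have hout : ∀ a x : ℝ, 2 * r ≤ dist (a : UnitAddCircle) c → |x - a| ≤ r →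
      (x : UnitAddCircle) ∉ Metric.ball c r := by
    intro a x ha hx hmem
    rw [Metric.mem_ball] at hmem
    have h3 := aux_dist_le x a
    have h4 := dist_triangle_left (a : UnitAddCircle) c x
    linarith
  have hlam : ∀ a b : ℝ, 2 * r ≤ dist (a : UnitAddCircle) c → |a - b| ≤ 1 →
      (1 + (C - 1) * r) * |a - b| ≤ |F a - F b| := by
    intro a b ha hab
    rcases le_total a b with h | h
    · rw [abs_sub_comm, abs_sub_comm (F a)]
      rw [abs_sub_comm] at hab
      rw [abs_of_nonneg (by linarith)] at hab ⊢
      obtain ⟨m, hm⟩ : ∃ m, m = min (b - a) r := ⟨_, rfl⟩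
      have hm1 : m ≤ b - a := by rw [hm]; exact min_le_left _ _
      have hm2 : m ≤ r := by rw [hm]; exact min_le_right _ _
      have hm0 : 0 ≤ m := by rw [hm]; exact le_min (by linarith) hr0.le
      have hm3 : r * (b - a) ≤ m := by
        rw [hm]; exact le_min (by nlinarith) (by nlinarith)
      have e1 := aux_expand F hFmono C a (a + m) (by linarith) (by
        filter_upwards [hCe] with x hx hxm
        exact hx (hout a x ha (by rw [abs_of_nonneg (by linarith [hxm.1])]; linarith [hxm.2])))
      have e2 := h1 (a + m) b (by linarith)
      have e3 : (C - 1) * (r * (b - a)) ≤ (C - 1) * m := by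
        apply mul_le_mul_of_nonneg_left hm3; linarith
      refine le_trans ?_ (le_abs_self _)
      nlinarith
    · rw [abs_of_nonneg (by linarith)] at hab ⊢
      obtain ⟨m, hm⟩ : ∃ m, m = min (a - b) r := ⟨_, rfl⟩
      have hm1 : m ≤ a - b := by rw [hm]; exact min_le_left _ _
      have hm2 : m ≤ r := by rw [hm]; exact min_le_right _ _
      have hm0 : 0 ≤ m := by rw [hm]; exact le_min (by linarith) hr0.le
      have hm3 : r * (a - b) ≤ m := by
        rw [hm]; exact le_min (by nlinarith) (by nlinarith)
      have e1 := aux_expand F hFmono C (a - m) a (by linarith) (by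
        filter_upwards [hCe] with x hx hxm
        exact hx (hout a x ha (by
          rw [abs_sub_comm, abs_of_nonneg (by linarith [hxm.2])]; linarith [hxm.1])))
      have e2 := h1 b (a - m) (by linarith)
      have e3 : (C - 1) * (r * (a - b)) ≤ (C - 1) * m := by
        apply mul_le_mul_of_nonneg_left hm3; linarith
      refine le_trans ?_ (le_abs_self _)
      nlinarith
  obtain ⟨B, hB⟩ : ∃ B, ∀ x, φ x ≤ B := by
    obtain ⟨B, hB⟩ := (isCompact_range hφ.continuous).bddAbove
    exact ⟨B, fun x => hB ⟨x, rfl⟩⟩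
  obtain ⟨lam, hl⟩ : ∃ lam, lam = 1 + (C - 1) * r := ⟨_, rfl⟩
  have hl1 : 1 < lam := by rw [hl]; nlinarith
  rw [← hl] at hlam
  obtain ⟨D, hD⟩ : ∃ D, D = |B| + |β| + δ := ⟨_, rfl⟩
  have hD0 : 0 < D := by rw [hD]; positivity
  refine ⟨Real.log lam / D, δ, div_pos (Real.log_pos hl1) hD0, hδ0, fun a b hab => ?_⟩
  have hs0 : 0 < Real.log lam / D := div_pos (Real.log_pos hl1) hD0
  rcases lt_or_ge (dist (a : UnitAddCircle) c) (2 * r) with h | h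
  · have := hV _ h
    have h3 : 1 ≤ Real.exp (-(Real.log lam / D) * (φ a - β + δ)) := by
      apply Real.one_le_exp; nlinarith
    calc |a - b| ≤ |F a - F b| := h1' a b
      _ ≤ _ := le_mul_of_one_le_left (abs_nonneg _) h3
  · have h3 : φ a - β + δ ≤ D := by
      rw [hD]; linarith [hB a, le_abs_self B, neg_abs_le β]
    have h4 : Real.exp (-Real.log lam) ≤ Real.exp (-(Real.log lam / D) * (φ a - β + δ)) := by
      apply Real.exp_le_exp.2
      have : Real.log lam / D * (φ a - β + δ) ≤ Real.log lam / D * D :=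
        mul_le_mul_of_nonneg_left h3 hs0.le
      rw [div_mul_cancel₀ _ hD0.ne'] at this
      linarith
    rw [Real.exp_neg, Real.exp_log (by linarith)] at h4
    calc |a - b| = lam⁻¹ * (lam * |a - b|) := by field_simp
      _ ≤ lam⁻¹ * |F a - F b| := by
        apply mul_le_mul_of_nonneg_left (hlam a b h hab); positivity
      _ ≤ _ := mul_le_mul_of_nonneg_right h4 (abs_nonneg _)

/-- abstract summation lemma -/
lemma aux_sum (s δ D : ℝ) (hs : 0 < s) (hδ : 0 < δ) (n : ℕ) (e u : ℕ → ℝ)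
    (hen : 0 ≤ e n)
    (hstep : ∀ k < n, e k ≤ Real.exp (-s * (u k + δ)) * e (k + 1))
    (hsuf : ∀ m ≤ n, -D ≤ ∑ k ∈ Finset.range n, u k - ∑ k ∈ Finset.range m, u k) :
    ∑ k ∈ Finset.range n, e k ≤ Real.exp (s * D) * (1 - Real.exp (-s * δ))⁻¹ * e n := by
  have h1 : ∀ j ≤ n, e (n - j) ≤ Real.exp (-s * ((∑ k ∈ Finset.range n, u k -
      ∑ k ∈ Finset.range (n - j), u k) + j * δ)) * e n := by
    intro j
    induction j with
    | zero => intro _; simp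
    | succ j ih =>
      intro hj
      have h2 := ih (by omega)
      have h3 := hstep (n - (j + 1)) (by omega)
      have h4 : n - (j + 1) + 1 = n - j := by omega
      rw [h4] at h3
      refine h3.trans ((mul_le_mul_of_nonneg_left h2 (Real.exp_pos _).le).trans (le_of_eq ?_))
      rw [← mul_assoc, ← Real.exp_add]
      congr 2
      rw [← h4, Finset.sum_range_succ]
      push_cast
      ring
  have hq1 : Real.exp (-s * δ) < 1 := by
    rw [Real.exp_lt_one_iff]; nlinarith
  have hq0 := (Real.exp_pos (-s * δ)).le
  have h2 : ∀ k ∈ Finset.range n, e (n - 1 - k) ≤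
      Real.exp (s * D) * e n * Real.exp (-s * δ) ^ k := by
    intro k hk
    rw [Finset.mem_range] at hk
    have h3 := h1 (k + 1) hk
    have h4 := hsuf (n - (k + 1)) (by omega)
    have h5 : n - 1 - k = n - (k + 1) := by omega
    rw [h5]
    refine h3.trans ?_
    rw [← Real.exp_nat_mul, mul_right_comm, ← Real.exp_add]
    refine mul_le_mul_of_nonneg_right (Real.exp_le_exp.2 ?_) hen
    push_cast
    have := mul_le_mul_of_nonneg_left h4 hs.le
    have := mul_pos hs hδ
    nlinarith
  rw [← Finset.sum_range_reflect]
  refine (Finset.sum_le_sum h2).trans ?_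
  rw [← Finset.mul_sum]
  have h6 : ∑ k ∈ Finset.range n, Real.exp (-s * δ) ^ k ≤ (1 - Real.exp (-s * δ))⁻¹ := by
    rw [← tsum_geometric_of_lt_one hq0 hq1]
    exact (summable_geometric_of_lt_one hq0 hq1).sum_le_tsum _ (fun i _ => pow_nonneg hq0 i)
  calc _ ≤ Real.exp (s * D) * e n * (1 - Real.exp (-s * δ))⁻¹ :=
        mul_le_mul_of_nonneg_left h6 (mul_nonneg (Real.exp_pos _).le hen)
    _ = _ := by ring

lemma aux_bddAbove (T : UnitAddCircle → UnitAddCircle) (φ : UnitAddCircle → ℝ) (Kφ : NNReal) (hφ : LipschitzWith Kφ φ) :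
    BddAbove ((fun μ : Measure UnitAddCircle => ∫ x, φ x ∂μ) ''
    {μ : Measure UnitAddCircle | IsProbabilityMeasure μ ∧ μ.map T = μ}) := by
  obtain ⟨B, hB⟩ := (isCompact_range hφ.continuous.norm).bddAbove
  refine ⟨B, ?_⟩
  rintro _ ⟨μ, ⟨hμ, _⟩, rfl⟩
  have := norm_integral_le_of_norm_le_const (μ := μ) (f := φ) (C := B)
    (Filter.Eventually.of_forall fun x => hB ⟨x, rfl⟩)
  have h2 := (Real.le_norm_self _).trans this
  simpa using h2

lemma aux_periodic (T : UnitAddCircle → UnitAddCircle) (hTcont : Continuous T)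
    (φ : UnitAddCircle → ℝ) (Kφ : NNReal) (hφ : LipschitzWith Kφ φ) (n : ℕ) (hn : 1 ≤ n)
    (p : UnitAddCircle) (hp : T^[n] p = p) :
    ∑ k ∈ Finset.range n, φ (T^[k] p) ≤ n * beta T φ := by
  have hn0 : (0:ℝ) < n := by exact_mod_cast hn
  let ν : Measure UnitAddCircle := ∑ k ∈ Finset.range n, Measure.dirac (T^[k] p)
  let μ : Measure UnitAddCircle := (n : ENNReal)⁻¹ • ν
  have hne : (n : ENNReal) ≠ 0 := by exact_mod_cast (by omega : n ≠ 0)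
  have hμ : IsProbabilityMeasure μ := by
    constructor
    simp only [μ, ν, Measure.smul_apply, Measure.finsetSum_apply, measure_univ, smul_eq_mul,
      Finset.sum_const, Finset.card_range, nsmul_eq_mul, mul_one]
    exact ENNReal.inv_mul_cancel hne (ENNReal.natCast_ne_top n)
  have hinv : μ.map T = μ := by
    simp only [μ, Measure.map_smul]
    congr 1
    simp only [ν]
    rw [Measure.map_finset_sum hTcont.measurable.aemeasurable]
    simp only [Measure.map_dirac' hTcont.measurable, ← Function.iterate_succ_apply']
    obtain ⟨m, rfl⟩ : ∃ m, n = m + 1 := ⟨n - 1, by omega⟩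
    rw [Finset.sum_range_succ, Finset.sum_range_succ', hp]
    rfl
  have hle : ∫ x, φ x ∂μ ≤ beta T φ :=
    le_csSup (aux_bddAbove T φ Kφ hφ) ⟨μ, ⟨hμ, hinv⟩, rfl⟩
  have hint : ∫ x, φ x ∂μ = (n:ℝ)⁻¹ * ∑ k ∈ Finset.range n, φ (T^[k] p) := by
    simp only [μ, ν]
    rw [integral_smul_measure, integral_finsetSum_measure]
    · simp
    · intro i _
      exact integrable_dirac (by simp)
  rw [hint, inv_mul_le_iff₀ hn0] at hle
  exact hle

lemma aux_iter_lift (T : UnitAddCircle → UnitAddCircle) (F : ℝ → ℝ)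
    (hlift : ∀ x : ℝ, T (x : UnitAddCircle) = ((F x : ℝ) : UnitAddCircle)) (n : ℕ) (a : ℝ) :
    T^[n] (a : UnitAddCircle) = ((F^[n] a : ℝ) : UnitAddCircle) := by
  induction n with
  | zero => rfl
  | succ n ih => rw [Function.iterate_succ_apply', Function.iterate_succ_apply', ih, hlift]

lemma aux_iter_deg (F : ℝ → ℝ) (d : ℤ) (hd : 2 ≤ d)
    (hdeg : ∀ x : ℝ, F (x + 1) = F x + d) (n : ℕ) :
    ∃ D : ℕ, (1 ≤ n → 2 ≤ D) ∧ ∀ x, F^[n] (x + 1) = F^[n] x + D := by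
  have hk : ∀ (k : ℕ) (x : ℝ), F (x + k) = F x + k * d := by
    intro k
    induction k with
    | zero => intro x; simp
    | succ k ih => intro x; push_cast; rw [← add_assoc, hdeg, ih]; ring
  lift d to ℕ using (by omega)
  induction n with
  | zero => exact ⟨1, by simp, by simp⟩
  | succ n ih =>
    obtain ⟨D, hD, h⟩ := ih
    refine ⟨D * d, ?_, ?_⟩
    · intro _
      rcases Nat.eq_zero_or_pos n with h0 | h0
      · subst h0
        have := h 0
        simp at this
        have h1 : D = 1 := by exact_mod_cast this.symm
        subst h1
        omega
      · have := hD h0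
        have : 2 ≤ d := by omega
        nlinarith
    · intro x
      rw [Function.iterate_succ_apply', Function.iterate_succ_apply', h, hk]
      push_cast; ring

lemma aux_surj (F : ℝ → ℝ) (hc : Continuous F) (h1 : ∀ a b, a ≤ b → b - a ≤ F b - F a) :
    Function.Surjective F := by
  apply hc.surjective
  · refine Filter.tendsto_atTop_mono' _ ?_ (Filter.tendsto_atTop_add_const_right _ (F 0) Filter.tendsto_id)
    filter_upwards [Filter.eventually_ge_atTop 0] with x hx
    have := h1 0 x hx
    simp only [id]; linarith
  · refine Filter.tendsto_atBot_mono' _ ?_ (Filter.tendsto_atBot_add_const_right _ (F 0) Filter.tendsto_id)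
    filter_upwards [Filter.eventually_le_atBot 0] with x hx
    have := h1 x 0 hx
    simp only [id]; linarith

lemma aux_iter_expand (F : ℝ → ℝ) (h1 : ∀ a b, a ≤ b → b - a ≤ F b - F a) (n : ℕ) :
    ∀ a b, a ≤ b → b - a ≤ F^[n] b - F^[n] a := by
  induction n with
  | zero => intro a b _; simp
  | succ n ih =>
    intro a b hab
    have h2 := ih a b hab
    have h3 := h1 (F^[n] a) (F^[n] b) (by linarith)
    rw [Function.iterate_succ_apply', Function.iterate_succ_apply']
    linarith

lemma aux_abs_expand (G : ℝ → ℝ) (h1 : ∀ a b, a ≤ b → b - a ≤ G b - G a) (a b : ℝ) :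
    |a - b| ≤ |G a - G b| := by
  rcases le_total a b with h | h
  · rw [abs_sub_comm, abs_sub_comm (G a), abs_of_nonneg (by linarith)]
    exact (h1 a b h).trans (le_abs_self _)
  · rw [abs_of_nonneg (by linarith)]
    exact (h1 b a h).trans (le_abs_self _)

/-- comparison of Birkhoff sums along the same inverse branch -/
lemma aux_compare (T : UnitAddCircle → UnitAddCircle) (F : ℝ → ℝ)
    (hlift : ∀ x : ℝ, T (x : UnitAddCircle) = ((F x : ℝ) : UnitAddCircle))
    (h1 : ∀ a b, a ≤ b → b - a ≤ F b - F a)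
    (φ : UnitAddCircle → ℝ) (Kφ : NNReal) (hφ : LipschitzWith Kφ φ) (β s δ : ℝ)
    (hs : 0 < s) (hδ : 0 < δ)
    (hcon : ∀ a b : ℝ, |a - b| ≤ 1 →
      |a - b| ≤ Real.exp (-s * (φ a - β + δ)) * |F a - F b|)
    (D : ℝ) (n : ℕ) (a b : ℝ) (hab : |F^[n] a - F^[n] b| ≤ 1)
    (hsuf : ∀ m ≤ n, -D ≤ (∑ k ∈ Finset.range n, φ (T^[k] a) - n * β) -
      (∑ k ∈ Finset.range m, φ (T^[k] a) - m * β)) :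
    ∑ k ∈ Finset.range n, φ (T^[k] a) ≤ ∑ k ∈ Finset.range n, φ (T^[k] b) +
      Kφ * (Real.exp (s * D) * (1 - Real.exp (-s * δ))⁻¹) * |F^[n] a - F^[n] b| := by
  have hmono : ∀ k < n, |F^[k] a - F^[k] b| ≤ 1 := by
    intro k hk
    refine le_trans ?_ hab
    obtain ⟨j, rfl⟩ : ∃ j, n = j + k := ⟨n - k, by omega⟩
    rw [Function.iterate_add_apply, Function.iterate_add_apply]
    exact aux_abs_expand _ (aux_iter_expand F h1 j) _ _
  have hsum := aux_sum s δ D hs hδ n (fun k => |F^[k] a - F^[k] b|)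
    (fun k => φ (T^[k] a) - β) (abs_nonneg _) (by
      intro k hk
      have := hcon _ _ (hmono k hk)
      simp only [aux_iter_lift T F hlift, Function.iterate_succ_apply']
      exact this) (by
      intro m hm
      simpa [Finset.sum_sub_distrib] using hsuf m hm)
  have h3 : ∑ k ∈ Finset.range n, φ (T^[k] a) ≤ ∑ k ∈ Finset.range n,
      (φ (T^[k] b) + Kφ * |F^[k] a - F^[k] b|) := by
    apply Finset.sum_le_sum
    intro k _
    have h4 := hφ.dist_le_mul (T^[k] a) (T^[k] b)
    rw [Real.dist_eq] at h4
    have h5 := (le_abs_self _).trans h4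
    have h6 : dist (T^[k] (a : UnitAddCircle)) (T^[k] b) ≤ |F^[k] a - F^[k] b| := by
      rw [aux_iter_lift T F hlift, aux_iter_lift T F hlift]; exact aux_dist_le _ _
    have h7 := mul_le_mul_of_nonneg_left h6 Kφ.2
    have h8 : (Kφ : ℝ) * dist (T^[k] (a : UnitAddCircle)) (T^[k] b) ≤
      Kφ * |F^[k] a - F^[k] b| := h7
    linarith
  rw [Finset.sum_add_distrib, ← Finset.mul_sum] at h3
  have h9 : (Kφ : ℝ) * ∑ k ∈ Finset.range n, |F^[k] a - F^[k] b| ≤ Kφ * _ :=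
    mul_le_mul_of_nonneg_left hsum Kφ.2
  rw [← mul_assoc] at h9
  linarith

/-- closing lemma -/
lemma aux_closing (F : ℝ → ℝ) (hc : Continuous F) (h1 : ∀ a b, a ≤ b → b - a ≤ F b - F a)
    (d : ℤ) (hd : 2 ≤ d) (hdeg : ∀ x : ℝ, F (x + 1) = F x + d) (n : ℕ) (hn : 1 ≤ n) (a : ℝ) :
    ∃ p : ℝ, ∃ m : ℤ, F^[n] p = p + m ∧ |F^[n] a - F^[n] p| ≤ 1 := by
  have hGc := hc.iterate n
  have hGs := (aux_surj F hc h1).iterate n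
  have hGe := aux_iter_expand F h1 n
  obtain ⟨D, hD, hG1⟩ := aux_iter_deg F d hd hdeg n
  have hD2 : (2:ℝ) ≤ D := by exact_mod_cast hD hn
  generalize F^[n] = G at *
  have hmono : ∀ x y, G x ≤ G y → x ≤ y := by
    intro x y h
    by_contra! hlt
    have := hGe y x hlt.le
    linarith
  have hmono' : ∀ x y, x ≤ y → G x ≤ G y := fun x y h => by linarith [hGe x y h]
  obtain ⟨u, hu⟩ := hGs (G a - 1)
  obtain ⟨v, hv⟩ := hGs (G a + 1)
  have huv : u ≤ v := hmono _ _ (by linarith)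
  have hlen : v ≤ u + 1 := hmono _ _ (by rw [hG1]; linarith)
  obtain ⟨p, hp, hpm⟩ : ∃ p ∈ Icc u v, G p - p = (⌈G u - u⌉ : ℤ) := by
    have := intermediate_value_Icc huv (f := fun t => G t - t) (by fun_prop)
    apply this
    refine ⟨Int.le_ceil _, ?_⟩
    have := Int.ceil_lt_add_one (G u - u)
    linarith
  refine ⟨p, ⌈G u - u⌉, by linarith, ?_⟩
  have := hmono' _ _ hp.1
  have := hmono' _ _ hp.2
  rw [abs_le]; constructor <;> linarith

/-- for a Lipschitz circle covering map of degree ≥ 2 expanding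
away from its fixed point `c`, and `φ` Lipschitz with `φ(c) < β(φ)`, the
function `ψ(x) = sup_{n≥1} max_{T^n y = x} (S_n φ(y) - n β(φ))` is a
real-valued Lipschitz sub-action of `φ`. -/
theorem stmt14
    (T : UnitAddCircle → UnitAddCircle) (hTcont : Continuous T)
    (hTsurj : Function.Surjective T)
    (F : ℝ → ℝ) (KF : NNReal) (hF : LipschitzWith KF F) (hFmono : Monotone F)
    (d : ℤ) (hd : 2 ≤ |d|) (hdeg : ∀ x : ℝ, F (x + 1) = F x + d)
    (hlift : ∀ x : ℝ, T (x : UnitAddCircle) = ((F x : ℝ) : UnitAddCircle))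
    (c : UnitAddCircle) (hc : T c = c)
    -- expanding away from `c`
    (hexp : ∀ V : Set UnitAddCircle, IsOpen V → c ∈ V →
      ∃ C : ℝ, 1 < C ∧ ∀ᵐ x : ℝ, ((x : UnitAddCircle) ∉ V → C ≤ |deriv F x|))
    (φ : UnitAddCircle → ℝ) (Kφ : NNReal) (hφ : LipschitzWith Kφ φ)
    (hgap : φ c < beta T φ) :
    (∀ x : UnitAddCircle, (subActSet T φ x).Nonempty ∧ BddAbove (subActSet T φ x)) ∧
    (∃ L : NNReal, LipschitzWith L (fun x => sSup (subActSet T φ x))) ∧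
    (∀ x : UnitAddCircle,
      φ x ≤ sSup (subActSet T φ (T x)) - sSup (subActSet T φ x) + beta T φ) := by
  have hd0 : 2 ≤ d := by
    have h0 := hdeg 0
    have h2 := hFmono (show (0:ℝ) ≤ 0 + 1 by norm_num)
    have h3 : (0:ℝ) ≤ d := by linarith
    have h4 : 0 ≤ d := by exact_mod_cast h3
    rwa [abs_of_nonneg h4] at hd
  have h1 := aux_expand_one F hFmono c hexp
  have hFc := hF.continuous
  obtain ⟨s, δ, hs, hδ, hcon⟩ := aux_contract F hFmono c hexp φ Kφ hφ (beta T φ) hgap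
  have hcmp := aux_compare T F hlift h1 φ Kφ hφ (beta T φ) s δ hs hδ hcon
  have hper := aux_periodic T hTcont φ Kφ hφ
  have hmem : ∀ x r, r ∈ subActSet T φ x ↔ ∃ n : ℕ, 1 ≤ n ∧ ∃ y : UnitAddCircle, T^[n] y = x ∧
    r = ∑ k ∈ Finset.range n, φ (T^[k] y) - n * beta T φ := fun x r => Iff.rfl
  have hsub : ∀ x r, r ∈ subActSet T φ x → r + (φ x - beta T φ) ∈ subActSet T φ (T x) := by
    rintro x r ⟨n, hn, y, hy, rfl⟩
    refine ⟨n + 1, by omega, y, by rw [Function.iterate_succ_apply', hy], ?_⟩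
    rw [Finset.sum_range_succ, hy]
    push_cast; ring
  generalize beta T φ = β at *
  have hq1 : 0 < 1 - Real.exp (-s * δ) := by
    rw [sub_pos, Real.exp_lt_one_iff]; nlinarith
  -- uniform bound
  obtain ⟨M, hM0, hM⟩ : ∃ M : ℝ, 0 ≤ M ∧ ∀ (n : ℕ) (y : UnitAddCircle),
      ∑ k ∈ Finset.range n, φ (T^[k] y) - n * β ≤ M := by
    refine ⟨Kφ * (Real.exp (s * 0) * (1 - Real.exp (-s * δ))⁻¹), by positivity, fun N y => ?_⟩
    obtain ⟨a, rfl⟩ := QuotientAddGroup.mk_surjective y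
    obtain ⟨n, hn, hmax⟩ := Finset.exists_max_image (Finset.range (N + 1))
      (fun n => ∑ k ∈ Finset.range n, φ (T^[k] (a : UnitAddCircle)) - n * β) ⟨0, by simp⟩
    refine (hmax N (by simp)).trans ?_
    rcases Nat.eq_zero_or_pos n with h0 | h0
    · subst h0
      simp only [Finset.range_zero, Finset.sum_empty, Nat.cast_zero, zero_mul, sub_self]
      positivity
    obtain ⟨p, m, hpm, hp⟩ := aux_closing F hFc h1 d hd0 hdeg n h0 a
    have h2 := hcmp 0 n a p hp (by
      intro m hm
      have := hmax m (by simp at hn ⊢; omega)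
      linarith)
    have h3 := hper n h0 p (by
      rw [aux_iter_lift T F hlift, hpm]
      simp)
    have h4 : Kφ * (Real.exp (s * 0) * (1 - Real.exp (-s * δ))⁻¹) * |F^[n] a - F^[n] p| ≤
      Kφ * (Real.exp (s * 0) * (1 - Real.exp (-s * δ))⁻¹) :=
      mul_le_of_le_one_right (by positivity) hp
    change ∑ k ∈ Finset.range n, φ (T^[k] (a : UnitAddCircle)) - n * β ≤ _
    linarith
  have hne : ∀ x, (subActSet T φ x).Nonempty := by
    intro x
    obtain ⟨y, hy⟩ := hTsurj x
    exact ⟨_, (hmem _ _).2 ⟨1, le_rfl, y, hy, rfl⟩⟩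
  have hbdd : ∀ x, BddAbove (subActSet T φ x) := by
    intro x
    refine ⟨M, fun r hr => ?_⟩
    obtain ⟨n, hn, y, hy, rfl⟩ := (hmem _ _).1 hr
    exact hM n y
  refine ⟨fun x => ⟨hne x, hbdd x⟩, ?_, ?_⟩
  · obtain ⟨B, hB⟩ : ∃ B, ∀ x, -B ≤ φ x - β := by
      obtain ⟨B, hB⟩ := (isCompact_range hφ.continuous).bddBelow
      exact ⟨-(B - β), fun x => by linarith [hB ⟨x, rfl⟩]⟩
    obtain ⟨L, hL⟩ : ∃ L : ℝ, L = Kφ * (Real.exp (s * (B + M)) * (1 - Real.exp (-s * δ))⁻¹) :=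
      ⟨_, rfl⟩
    have hL0 : 0 ≤ L := by rw [hL]; positivity
    have hlow : ∀ x, -B ≤ sSup (subActSet T φ x) := by
      intro x
      obtain ⟨y, hy⟩ := hTsurj x
      have := le_csSup (hbdd x) ((hmem _ _).2 ⟨1, le_rfl, y, hy, rfl⟩)
      simp at this
      linarith [hB y]
    refine ⟨L.toNNReal, LipschitzWith.of_le_add_mul _ fun x x' => ?_⟩
    rw [Real.coe_toNNReal _ hL0]
    apply csSup_le (hne x)
    intro r hr
    have hdn : 0 ≤ L * dist x x' := mul_nonneg hL0 dist_nonneg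
    rcases lt_or_ge r (-B) with hrB | hrB
    · linarith [hlow x']
    obtain ⟨n, hn, y, hy, rfl⟩ := (hmem _ _).1 hr
    obtain ⟨a, rfl⟩ := QuotientAddGroup.mk_surjective y
    obtain ⟨t, rfl⟩ := QuotientAddGroup.mk_surjective x'
    have hy' : ((F^[n] a : ℝ) : UnitAddCircle) = x := by
      rw [← aux_iter_lift T F hlift]; exact hy
    obtain ⟨b, hb⟩ := (aux_surj F hFc h1).iterate n (t + round (F^[n] a - t))
    have hdist : |F^[n] a - F^[n] b| = dist x (t : UnitAddCircle) := by
      rw [← hy', dist_eq_norm, ← AddCircle.coe_sub, UnitAddCircle.norm_eq, hb]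
      congr 1; ring
    have hle1 : |F^[n] a - F^[n] b| ≤ 1 := by
      have := abs_sub_round (F^[n] a - t)
      rw [hb, ← sub_sub]
      linarith
    have h2 := hcmp (B + M) n a b hle1 (by
      intro m hm
      have h3 := hM m a
      have h4 : -B ≤ ∑ k ∈ Finset.range n, φ (T^[k] (a : UnitAddCircle)) - n * β := hrB
      linarith)
    rw [← hL, hdist] at h2
    have h5 := le_csSup (hbdd t) ((hmem _ _).2 ⟨n, hn, b, by
      rw [aux_iter_lift T F hlift, hb]; simp, rfl⟩)
    change ∑ k ∈ Finset.range n, φ (T^[k] (a : UnitAddCircle)) - n * β ≤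
      sSup (subActSet T φ (t : UnitAddCircle)) + L * dist x (t : UnitAddCircle)
    linarith
  · intro x
    have : sSup (subActSet T φ x) ≤ sSup (subActSet T φ (T x)) - (φ x - β) := by
      apply csSup_le (hne x)
      intro r hr
      have := le_csSup (hbdd (T x)) (hsub x r hr)
      linarith
    linarith
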